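/- arXiv:2107.12723 — 2 statements merged into one kernel-verified Lean document; each statement's English description precedes it below -/
import Mathlib

section
/- (Operator-norm bound on the network Hessian) For any W ∈ ℝ^{d×m} and any x ∈ ℝ^d with ‖x‖₂ ≤ C_x, the Hessian ∇²f_W(x) ∈ ℝ^{dm×dm} of the network output with respect to the vectorised parameters (the block-diagonal matrix whose k-th d×d block is u_k x xᵀ φ''(⟨W_k, x⟩)) has operator norm at most C_x² B_{φ''}/√m. -/
open MeasureTheory Finset
open scoped BigOperators

noncomputable section

/-- The parameter space of a width-`m` shallow network on `ℝ^d`, with the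
Euclidean (= Frobenius, after vectorisation) norm. -/
abbrev Param (d m : ℕ) : Type := EuclideanSpace ℝ (Fin m × Fin d)

/-- Inputs live in `ℝ^d` with the Euclidean norm. -/
abbrev Input (d : ℕ) : Type := EuclideanSpace ℝ (Fin d)

/-- Shallow network `f_W(x) = ∑ₖ uₖ φ(⟨Wₖ, x⟩)`. -/
def nnet {d m : ℕ} (φ : ℝ → ℝ) (u : Fin m → ℝ) (W : Param d m) (x : Input d) : ℝ :=
  ∑ k : Fin m, u k * φ (∑ j : Fin d, W (k, j) * x j)

/-- Squared loss `ℓ(W, (x, y)) = (f_W(x) − y)² / 2`. -/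
def sqLoss {d m : ℕ} (φ : ℝ → ℝ) (u : Fin m → ℝ) (W : Param d m) (z : Input d × ℝ) : ℝ :=
  (nnet φ u W z.1 - z.2) ^ 2 / 2

/-- Empirical risk `L_S(W) = (1/n) ∑ᵢ ℓ(W, zᵢ)`. -/
def empRisk {d m n : ℕ} (φ : ℝ → ℝ) (u : Fin m → ℝ) (S : Fin n → Input d × ℝ)
    (W : Param d m) : ℝ :=
  (∑ i : Fin n, sqLoss φ u W (S i)) / n

/-- Gradient-descent iterates `W_{t+1} = W_t − η ∇L(W_t)` started at `W0`. -/
def gdIter {d m : ℕ} (η : ℝ) (L : Param d m → ℝ) (W0 : Param d m) : ℕ → Param d m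
  | 0 => W0
  | t + 1 => gdIter η L W0 t - η • gradient L (gdIter η L W0 t)

end

/-- operator-norm bound on the (block-diagonal) Hessian of the network output,
expressed through its quadratic form `vᵀ(∇²f_W(x))v = ∑ₖ uₖ φ''(⟨Wₖ,x⟩)⟨x,vₖ⟩²`. -/
theorem statement13 {d m : ℕ} (hm : 1 ≤ m)
    (φ : ℝ → ℝ) (Bφ'' : ℝ)
    (hφ : Differentiable ℝ φ) (hφ' : Differentiable ℝ (deriv φ))
    (hBφ'' : ∀ s : ℝ, |deriv (deriv φ) s| ≤ Bφ'')
    (u : Fin m → ℝ) (hu : ∀ k, u k = 1 / Real.sqrt m ∨ u k = -(1 / Real.sqrt m))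
    (Cx : ℝ) (x : Input d) (hx : ‖x‖ ≤ Cx)
    (W : Param d m) (v : Param d m) :
    |∑ k : Fin m, u k * deriv (deriv φ) (∑ j : Fin d, W (k, j) * x j)
        * (∑ j : Fin d, v (k, j) * x j) ^ 2|
      ≤ Cx ^ 2 * Bφ'' / Real.sqrt m * ‖v‖ ^ 2 := by
  have hs : 0 ≤ 1 / Real.sqrt m := by positivity
  have hB : 0 ≤ Bφ'' := (abs_nonneg _).trans (hBφ'' 0)
  have huk : ∀ k, |u k| = 1 / Real.sqrt m := by
    intro k
    rcases hu k with h | h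
    · rw [h, abs_of_nonneg hs]
    · rw [h, abs_neg, abs_of_nonneg hs]
  have hx2 : ∑ j : Fin d, x j ^ 2 ≤ Cx ^ 2 := by
    rw [← EuclideanSpace.real_norm_sq_eq]
    exact pow_le_pow_left₀ (norm_nonneg _) hx 2
  have hv : ‖v‖ ^ 2 = ∑ k : Fin m, ∑ j : Fin d, v (k, j) ^ 2 := by
    rw [EuclideanSpace.real_norm_sq_eq, Fintype.sum_prod_type]
  rw [hv, Finset.mul_sum]
  refine (Finset.abs_sum_le_sum_abs _ _).trans (Finset.sum_le_sum fun k _ => ?_)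
  have hcs : (∑ j : Fin d, v (k, j) * x j) ^ 2 ≤ (∑ j : Fin d, v (k, j) ^ 2) * Cx ^ 2 :=
    (Finset.sum_mul_sq_le_sq_mul_sq _ _ _).trans
      (mul_le_mul_of_nonneg_left hx2 (Finset.sum_nonneg fun j _ => sq_nonneg _))
  rw [abs_mul, abs_mul, huk, abs_of_nonneg (sq_nonneg (∑ j : Fin d, v (k, j) * x j))]
  calc _ ≤ 1 / Real.sqrt m * Bφ'' * ((∑ j : Fin d, v (k, j) ^ 2) * Cx ^ 2) :=
        mul_le_mul (mul_le_mul_of_nonneg_left (hBφ'' _) hs) hcs (sq_nonneg _)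
          (mul_nonneg hs hB)
    _ = _ := by ring
end

section
/- (Approximate non-expansiveness of the leave-one-out GD update) Fix t ≥ 1 and i ∈ {1,…,n}, suppose η ≤ 1/(2ρ) and 2ηε < 1 with ε = 2 C_x² √C_0 B_{φ''} (4 B_{φ'} C_x √(ηt) + √2)/√m. Then the gradient-descent iterates W_t on S and W_t^{(i)} on S^{(i)} satisfy ‖W_t − W_t^{(i)} − η(∇L_{S∖i}(W_t) − ∇L_{S∖i}(W_t^{(i)}))‖_F² ≤ (1/(1 − 2ηε)) ‖W_t − W_t^{(i)}‖_F². -/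
open MeasureTheory Finset
open scoped BigOperators

/-- Leave-one-out empirical risk `L_{S∖i}(W) = L_S(W) − ℓ(W, zᵢ)/n`. -/
noncomputable def looRisk {d m n : ℕ} (φ : ℝ → ℝ) (u : Fin m → ℝ)
    (S : Fin n → Input d × ℝ) (i : Fin n) (W : Param d m) : ℝ :=
  empRisk φ u S W - sqLoss φ u W (S i) / n

noncomputable section Helpers

def pk {d m : ℕ} (k : Fin m) (W : Param d m) (x : Input d) : ℝ := ∑ j : Fin d, W (k, j) * x j

lemma pk_line {d m : ℕ} (k : Fin m) (W v : Param d m) (x : Input d) (s : ℝ) :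
    pk k (W + s • v) x = pk k W x + s * pk k v x := by
  simp only [pk, Finset.mul_sum, ← Finset.sum_add_distrib]
  refine Finset.sum_congr rfl fun j _ => ?_
  simp
  ring

lemma pk_sum_sq {d m : ℕ} (v : Param d m) (x : Input d) (Cx : ℝ) (hx : ‖x‖ ≤ Cx) :
    ∑ k, (pk k v x) ^ 2 ≤ Cx ^ 2 * ‖v‖ ^ 2 := by
  have h1 : ∑ k, (pk k v x) ^ 2 ≤ ‖x‖ ^ 2 * ‖v‖ ^ 2 := by
    rw [EuclideanSpace.real_norm_sq_eq v, EuclideanSpace.real_norm_sq_eq x,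
      Fintype.sum_prod_type, Finset.mul_sum]
    refine Finset.sum_le_sum fun k _ => ?_
    rw [mul_comm]
    exact Finset.sum_mul_sq_le_sq_mul_sq _ _ _
  refine h1.trans ?_
  gcongr

def Df {d m : ℕ} (φ : ℝ → ℝ) (u : Fin m → ℝ) (x : Input d) (W v : Param d m) : ℝ :=
  ∑ k, u k * (deriv φ (pk k W x) * pk k v x)

def D2f {d m : ℕ} (φ : ℝ → ℝ) (u : Fin m → ℝ) (x : Input d) (W v w : Param d m) : ℝ :=
  ∑ k, u k * (deriv (deriv φ) (pk k W x) * pk k v x * pk k w x)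

def Gl {d m : ℕ} (φ : ℝ → ℝ) (u : Fin m → ℝ) (z : Input d × ℝ) (W v : Param d m) : ℝ :=
  (nnet φ u W z.1 - z.2) * Df φ u z.1 W v

def Hl {d m : ℕ} (φ : ℝ → ℝ) (u : Fin m → ℝ) (z : Input d × ℝ) (W v w : Param d m) : ℝ :=
  Df φ u z.1 W v * Df φ u z.1 W w + (nnet φ u W z.1 - z.2) * D2f φ u z.1 W v w

lemma hasDeriv_pk {d m : ℕ} (k : Fin m) (W v : Param d m) (x : Input d) (s : ℝ) :
    HasDerivAt (fun s : ℝ => pk k (W + s • v) x) (pk k v x) s := by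
  simp only [pk_line]
  simpa using ((hasDerivAt_id s).mul_const (pk k v x)).const_add (pk k W x)

lemma hasDeriv_nnet {d m : ℕ} (φ : ℝ → ℝ) (hφ : Differentiable ℝ φ) (u : Fin m → ℝ)
    (x : Input d) (W v : Param d m) (s : ℝ) :
    HasDerivAt (fun s : ℝ => nnet φ u (W + s • v) x) (Df φ u x (W + s • v) v) s := by
  unfold nnet Df
  refine HasDerivAt.fun_sum fun k _ => ?_
  refine HasDerivAt.const_mul _ ?_
  exact HasDerivAt.comp s (hφ _).hasDerivAt (hasDeriv_pk k W v x s)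

lemma hasDeriv_Df {d m : ℕ} (φ : ℝ → ℝ) (hφ' : Differentiable ℝ (deriv φ)) (u : Fin m → ℝ)
    (x : Input d) (W v w : Param d m) (s : ℝ) :
    HasDerivAt (fun s : ℝ => Df φ u x (W + s • v) w) (D2f φ u x (W + s • v) v w) s := by
  unfold Df D2f
  refine HasDerivAt.fun_sum fun k _ => ?_
  refine HasDerivAt.const_mul _ ?_
  refine HasDerivAt.mul_const ?_ _
  exact HasDerivAt.comp s (hφ' _).hasDerivAt (hasDeriv_pk k W v x s)

lemma hasDeriv_loss {d m : ℕ} (φ : ℝ → ℝ) (hφ : Differentiable ℝ φ) (u : Fin m → ℝ)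
    (z : Input d × ℝ) (W v : Param d m) (s : ℝ) :
    HasDerivAt (fun s : ℝ => sqLoss φ u (W + s • v) z) (Gl φ u z (W + s • v) v) s := by
  unfold sqLoss Gl
  have h := (((hasDeriv_nnet φ hφ u z.1 W v s).sub_const z.2).pow 2).div_const 2
  refine h.congr_deriv ?_
  simp
  ring

lemma hasDeriv_Gl {d m : ℕ} (φ : ℝ → ℝ) (hφ : Differentiable ℝ φ)
    (hφ' : Differentiable ℝ (deriv φ)) (u : Fin m → ℝ)
    (z : Input d × ℝ) (W v w : Param d m) (s : ℝ) :
    HasDerivAt (fun s : ℝ => Gl φ u z (W + s • v) w) (Hl φ u z (W + s • v) v w) s := by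
  unfold Gl Hl
  exact ((hasDeriv_nnet φ hφ u z.1 W v s).sub_const z.2).mul (hasDeriv_Df φ hφ' u z.1 W v w s)

lemma diff_loss {d m : ℕ} (φ : ℝ → ℝ) (hφ : Differentiable ℝ φ) (u : Fin m → ℝ)
    (z : Input d × ℝ) : Differentiable ℝ (fun W : Param d m => sqLoss φ u W z) := by
  unfold sqLoss nnet
  fun_prop

/-- weighted risk -/
def wR {d m n : ℕ} (φ : ℝ → ℝ) (u : Fin m → ℝ) (S : Fin n → Input d × ℝ) (c : Fin n → ℝ)
    (W : Param d m) : ℝ := ∑ j, c j * sqLoss φ u W (S j)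

def wG {d m n : ℕ} (φ : ℝ → ℝ) (u : Fin m → ℝ) (S : Fin n → Input d × ℝ) (c : Fin n → ℝ)
    (W v : Param d m) : ℝ := ∑ j, c j * Gl φ u (S j) W v

def wH {d m n : ℕ} (φ : ℝ → ℝ) (u : Fin m → ℝ) (S : Fin n → Input d × ℝ) (c : Fin n → ℝ)
    (W v w : Param d m) : ℝ := ∑ j, c j * Hl φ u (S j) W v w

lemma hasDeriv_wR {d m n : ℕ} (φ : ℝ → ℝ) (hφ : Differentiable ℝ φ) (u : Fin m → ℝ)
    (S : Fin n → Input d × ℝ) (c : Fin n → ℝ) (W v : Param d m) (s : ℝ) :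
    HasDerivAt (fun s : ℝ => wR φ u S c (W + s • v)) (wG φ u S c (W + s • v) v) s :=
  HasDerivAt.fun_sum fun j _ => HasDerivAt.const_mul _ (hasDeriv_loss φ hφ u (S j) W v s)

lemma hasDeriv_wG {d m n : ℕ} (φ : ℝ → ℝ) (hφ : Differentiable ℝ φ)
    (hφ' : Differentiable ℝ (deriv φ)) (u : Fin m → ℝ)
    (S : Fin n → Input d × ℝ) (c : Fin n → ℝ) (W v w : Param d m) (s : ℝ) :
    HasDerivAt (fun s : ℝ => wG φ u S c (W + s • v) w) (wH φ u S c (W + s • v) v w) s :=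
  HasDerivAt.fun_sum fun j _ => HasDerivAt.const_mul _ (hasDeriv_Gl φ hφ hφ' u (S j) W v w s)

lemma inner_grad {d m n : ℕ} (φ : ℝ → ℝ) (hφ : Differentiable ℝ φ) (u : Fin m → ℝ)
    (S : Fin n → Input d × ℝ) (c : Fin n → ℝ) (W v : Param d m) :
    inner ℝ (gradient (wR φ u S c) W) v = wG φ u S c W v := by
  have hd : DifferentiableAt ℝ (wR φ u S c) W := by
    have : Differentiable ℝ (wR φ u S c) := by
      unfold wR
      exact Differentiable.fun_sum fun j _ => (diff_loss φ hφ u (S j)).const_mul _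
    exact this W
  have h1 : HasLineDerivAt ℝ (wR φ u S c) (fderiv ℝ (wR φ u S c) W v) W v :=
    hd.hasFDerivAt.hasLineDerivAt v
  have h2 := hasDeriv_wR φ hφ u S c W v 0
  have h3 := HasDerivAt.unique h1 h2
  simp only [zero_smul, add_zero] at h3
  rw [← h3, gradient, InnerProductSpace.toDual_symm_apply]

lemma usq {m : ℕ} (hm : 1 ≤ m) (u : Fin m → ℝ)
    (hu : ∀ k, u k = 1 / Real.sqrt m ∨ u k = -(1 / Real.sqrt m)) (k : Fin m) :
    (u k) ^ 2 = 1 / m ∧ |u k| = 1 / Real.sqrt m := by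
  have h0 : 0 ≤ 1 / Real.sqrt m := by positivity
  have h2 : (1 / Real.sqrt m) ^ 2 = 1 / m := by
    rw [div_pow, Real.sq_sqrt (by positivity)]; simp
  rcases hu k with h | h <;> rw [h]
  · exact ⟨h2, abs_of_nonneg h0⟩
  · exact ⟨by rw [neg_sq, h2], by rw [abs_neg, abs_of_nonneg h0]⟩

lemma Df_sq {d m : ℕ} (hm : 1 ≤ m) (φ : ℝ → ℝ) (B' : ℝ) (hB' : ∀ s : ℝ, |deriv φ s| ≤ B')
    (u : Fin m → ℝ) (hu : ∀ k, u k = 1 / Real.sqrt m ∨ u k = -(1 / Real.sqrt m))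
    (x : Input d) (Cx : ℝ) (hx : ‖x‖ ≤ Cx) (W v : Param d m) :
    (Df φ u x W v) ^ 2 ≤ B' ^ 2 * (Cx ^ 2 * ‖v‖ ^ 2) := by
  have hm' : (0 : ℝ) < m := by exact_mod_cast hm
  have h1 : Df φ u x W v = ∑ k, (u k * deriv φ (pk k W x)) * pk k v x := by
    unfold Df
    exact Finset.sum_congr rfl fun k _ => by ring
  rw [h1]
  refine (Finset.sum_mul_sq_le_sq_mul_sq _ _ _).trans ?_
  have h2 : ∑ k, (u k * deriv φ (pk k W x)) ^ 2 ≤ B' ^ 2 := by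
    calc ∑ k, (u k * deriv φ (pk k W x)) ^ 2 ≤ ∑ k : Fin m, 1 / (m : ℝ) * B' ^ 2 := by
          refine Finset.sum_le_sum fun k _ => ?_
          rw [mul_pow, (usq hm u hu k).1]
          refine mul_le_mul_of_nonneg_left ?_ (by positivity)
          exact sq_le_sq' (abs_le.1 (hB' _)).1 (abs_le.1 (hB' _)).2
      _ = B' ^ 2 := by
          simp
          field_simp
  exact mul_le_mul h2 (pk_sum_sq v x Cx hx) (Finset.sum_nonneg fun k _ => sq_nonneg _)
    (sq_nonneg _)

lemma D2f_abs {d m : ℕ} (hm : 1 ≤ m) (φ : ℝ → ℝ) (B'' : ℝ)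
    (hB'' : ∀ s : ℝ, |deriv (deriv φ) s| ≤ B'')
    (u : Fin m → ℝ) (hu : ∀ k, u k = 1 / Real.sqrt m ∨ u k = -(1 / Real.sqrt m))
    (x : Input d) (Cx : ℝ) (hx : ‖x‖ ≤ Cx) (W v : Param d m) :
    |D2f φ u x W v v| ≤ B'' / Real.sqrt m * (Cx ^ 2 * ‖v‖ ^ 2) := by
  have hB0 : 0 ≤ B'' := (abs_nonneg _).trans (hB'' 0)
  unfold D2f
  refine (Finset.abs_sum_le_sum_abs _ _).trans ?_
  calc _ ≤ ∑ k, B'' / Real.sqrt m * (pk k v x) ^ 2 := by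
        refine Finset.sum_le_sum fun k _ => ?_
        rw [mul_assoc (deriv (deriv φ) _), abs_mul, abs_mul, (usq hm u hu k).2, ← sq, abs_sq,
          ← mul_assoc, div_mul_eq_mul_div, one_mul]
        gcongr
        exact hB'' _
    _ ≤ _ := by
        rw [← Finset.mul_sum]
        exact mul_le_mul_of_nonneg_left (pk_sum_sq v x Cx hx) (by positivity)

lemma nnet_abs {d m : ℕ} (hm : 1 ≤ m) (φ : ℝ → ℝ) (B : ℝ) (hB : ∀ s : ℝ, |φ s| ≤ B)
    (u : Fin m → ℝ) (hu : ∀ k, u k = 1 / Real.sqrt m ∨ u k = -(1 / Real.sqrt m))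
    (x : Input d) (W : Param d m) : |nnet φ u W x| ≤ Real.sqrt m * B := by
  have hm' : (0 : ℝ) < m := by exact_mod_cast hm
  unfold nnet
  refine (Finset.abs_sum_le_sum_abs _ _).trans ?_
  calc _ ≤ ∑ k : Fin m, 1 / Real.sqrt m * B := by
        refine Finset.sum_le_sum fun k _ => ?_
        rw [abs_mul, (usq hm u hu k).2]
        gcongr
        exact hB _
    _ = _ := by
        simp
        have : Real.sqrt m * Real.sqrt m = m := Real.mul_self_sqrt hm'.le
        have h0 : 0 < Real.sqrt m := Real.sqrt_pos.2 hm'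
        field_simp
        rw [sq, this]

lemma nnet_lip {d m : ℕ} (hm : 1 ≤ m) (φ : ℝ → ℝ) (hφ : Differentiable ℝ φ) (B' : ℝ)
    (hB' : ∀ s : ℝ, |deriv φ s| ≤ B')
    (u : Fin m → ℝ) (hu : ∀ k, u k = 1 / Real.sqrt m ∨ u k = -(1 / Real.sqrt m))
    (x : Input d) (Cx : ℝ) (hCx : 0 < Cx) (hx : ‖x‖ ≤ Cx) (W V : Param d m) :
    |nnet φ u W x - nnet φ u V x| ≤ B' * Cx * ‖W - V‖ := by
  have hB0 : 0 ≤ B' := (abs_nonneg _).trans (hB' 0)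
  obtain ⟨s, -, hs⟩ := exists_hasDerivAt_eq_slope (fun s : ℝ => nnet φ u (V + s • (W - V)) x)
    _ (zero_lt_one) (fun s _ => (hasDeriv_nnet φ hφ u x V (W - V) s).continuousAt.continuousWithinAt)
    (fun s _ => hasDeriv_nnet φ hφ u x V (W - V) s)
  simp at hs
  rw [← hs]
  refine abs_le_of_sq_le_sq ?_ (by positivity)
  refine (Df_sq hm φ B' hB' u hu x Cx hx _ _).trans (le_of_eq ?_)
  ring

lemma Hl_lower {d m : ℕ} (hm : 1 ≤ m) (φ : ℝ → ℝ) (B'' : ℝ)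
    (hB'' : ∀ s : ℝ, |deriv (deriv φ) s| ≤ B'')
    (u : Fin m → ℝ) (hu : ∀ k, u k = 1 / Real.sqrt m ∨ u k = -(1 / Real.sqrt m))
    (z : Input d × ℝ) (Cx : ℝ) (hx : ‖z.1‖ ≤ Cx) (W v : Param d m) (b : ℝ)
    (hb : |nnet φ u W z.1 - z.2| ≤ b) :
    -(b * (B'' / Real.sqrt m * Cx ^ 2) * ‖v‖ ^ 2) ≤ Hl φ u z W v v := by
  unfold Hl
  have h1 := mul_self_nonneg (Df φ u z.1 W v)
  have h2 : |(nnet φ u W z.1 - z.2) * D2f φ u z.1 W v v|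
      ≤ b * (B'' / Real.sqrt m * (Cx ^ 2 * ‖v‖ ^ 2)) := by
    rw [abs_mul]
    exact mul_le_mul hb (D2f_abs hm φ B'' hB'' u hu z.1 Cx hx W v) (abs_nonneg _)
      ((abs_nonneg _).trans hb)
  have h3 := (abs_le.1 h2).1
  nlinarith

lemma Hl_upper {d m : ℕ} (hm : 1 ≤ m) (φ : ℝ → ℝ) (B B' B'' : ℝ) (hB : ∀ s : ℝ, |φ s| ≤ B)
    (hB' : ∀ s : ℝ, |deriv φ s| ≤ B')
    (hB'' : ∀ s : ℝ, |deriv (deriv φ) s| ≤ B'')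
    (u : Fin m → ℝ) (hu : ∀ k, u k = 1 / Real.sqrt m ∨ u k = -(1 / Real.sqrt m))
    (z : Input d × ℝ) (Cx Cy : ℝ) (hx : ‖z.1‖ ≤ Cx) (hy : |z.2| ≤ Cy) (W v : Param d m) :
    Hl φ u z W v v ≤ Cx ^ 2 * (B' ^ 2 + B'' * B + B'' * Cy / Real.sqrt m) * ‖v‖ ^ 2 := by
  have hm' : (0 : ℝ) < m := by exact_mod_cast hm
  have h0 : 0 < Real.sqrt m := Real.sqrt_pos.2 hm'
  unfold Hl
  have h1 := Df_sq hm φ B' hB' u hu z.1 Cx hx W v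
  have hb : |nnet φ u W z.1 - z.2| ≤ Real.sqrt m * B + Cy :=
    (abs_sub _ _).trans (add_le_add (nnet_abs hm φ B hB u hu z.1 W) hy)
  have h2 : |(nnet φ u W z.1 - z.2) * D2f φ u z.1 W v v|
      ≤ (Real.sqrt m * B + Cy) * (B'' / Real.sqrt m * (Cx ^ 2 * ‖v‖ ^ 2)) := by
    rw [abs_mul]
    exact mul_le_mul hb (D2f_abs hm φ B'' hB'' u hu z.1 Cx hx W v) (abs_nonneg _)
      ((abs_nonneg _).trans hb)
  have h3 := (abs_le.1 h2).2
  have h4 : (Real.sqrt m * B + Cy) * (B'' / Real.sqrt m * (Cx ^ 2 * ‖v‖ ^ 2))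
      = Cx ^ 2 * (B'' * B + B'' * Cy / Real.sqrt m) * ‖v‖ ^ 2 := by
    field_simp
  nlinarith

lemma wH_lower {d m n : ℕ} (φ : ℝ → ℝ) (u : Fin m → ℝ) (S : Fin n → Input d × ℝ) (c : Fin n → ℝ)
    (hc : ∀ j, 0 ≤ c j) (hc1 : ∑ j, c j ≤ 1) (W v : Param d m) (b : ℝ) (hb : 0 ≤ b)
    (h : ∀ j, -b ≤ Hl φ u (S j) W v v) : -b ≤ wH φ u S c W v v := by
  have : ∑ j, c j * (-b) ≤ wH φ u S c W v v :=
    Finset.sum_le_sum fun j _ => mul_le_mul_of_nonneg_left (h j) (hc j)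
  rw [← Finset.sum_mul] at this
  nlinarith

lemma wH_upper {d m n : ℕ} (φ : ℝ → ℝ) (u : Fin m → ℝ) (S : Fin n → Input d × ℝ) (c : Fin n → ℝ)
    (hc : ∀ j, 0 ≤ c j) (hc1 : ∑ j, c j ≤ 1) (W v : Param d m) (b : ℝ) (hb : 0 ≤ b)
    (h : ∀ j, Hl φ u (S j) W v v ≤ b) : wH φ u S c W v v ≤ b := by
  have : wH φ u S c W v v ≤ ∑ j, c j * b :=
    Finset.sum_le_sum fun j _ => mul_le_mul_of_nonneg_left (h j) (hc j)
  rw [← Finset.sum_mul] at this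
  nlinarith

lemma pk_comb {d m : ℕ} (k : Fin m) (x : Input d) (v w : Param d m) (r : ℝ) :
    pk k (v + r • w) x = pk k v x + r * pk k w x := pk_line k v w x r

lemma Df_comb {d m : ℕ} (φ : ℝ → ℝ) (u : Fin m → ℝ) (x : Input d) (W v w : Param d m) (r : ℝ) :
    Df φ u x W (v + r • w) = Df φ u x W v + r * Df φ u x W w := by
  simp only [Df, pk_comb, Finset.mul_sum, ← Finset.sum_add_distrib]
  exact Finset.sum_congr rfl fun k _ => by ring

lemma D2f_comb {d m : ℕ} (φ : ℝ → ℝ) (u : Fin m → ℝ) (x : Input d) (W v w : Param d m) (r : ℝ) :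
    D2f φ u x W (v + r • w) (v + r • w)
      = D2f φ u x W v v + 2 * r * D2f φ u x W v w + r ^ 2 * D2f φ u x W w w := by
  simp only [D2f, pk_comb, Finset.mul_sum, ← Finset.sum_add_distrib]
  exact Finset.sum_congr rfl fun k _ => by ring

lemma wH_comb {d m n : ℕ} (φ : ℝ → ℝ) (u : Fin m → ℝ) (S : Fin n → Input d × ℝ) (c : Fin n → ℝ)
    (W v w : Param d m) (r : ℝ) :
    wH φ u S c W (v + r • w) (v + r • w)
      = wH φ u S c W v v + 2 * r * wH φ u S c W v w + r ^ 2 * wH φ u S c W w w := by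
  simp only [wH, Hl, Df_comb, D2f_comb, Finset.mul_sum, ← Finset.sum_add_distrib]
  exact Finset.sum_congr rfl fun k _ => by ring

/-- one step of descent -/
lemma descent {d m n : ℕ} (φ : ℝ → ℝ) (hφ : Differentiable ℝ φ)
    (hφ' : Differentiable ℝ (deriv φ)) (u : Fin m → ℝ) (S : Fin n → Input d × ℝ) (c : Fin n → ℝ)
    (ρ η : ℝ) (hρ : 0 ≤ ρ) (hη : 0 < η) (hηρ : η * ρ ≤ 1 / 2)
    (hH : ∀ W v : Param d m, wH φ u S c W v v ≤ ρ * ‖v‖ ^ 2) (W : Param d m) :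
    wR φ u S c (W - η • gradient (wR φ u S c) W)
      ≤ wR φ u S c W - η / 2 * ‖gradient (wR φ u S c) W‖ ^ 2 := by
  set g := gradient (wR φ u S c) W with hg
  set v : Param d m := -(η • g) with hv
  have hvn : ‖v‖ ^ 2 = η ^ 2 * ‖g‖ ^ 2 := by
    rw [hv, norm_neg, norm_smul, mul_pow, Real.norm_eq_abs, sq_abs]
  obtain ⟨s, hs0, hs⟩ := exists_hasDerivAt_eq_slope (fun s : ℝ => wR φ u S c (W + s • v))
    _ (zero_lt_one) (fun s _ => (hasDeriv_wR φ hφ u S c W v s).continuousAt.continuousWithinAt)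
    (fun s _ => hasDeriv_wR φ hφ u S c W v s)
  obtain ⟨r, -, hr⟩ := exists_hasDerivAt_eq_slope (fun s : ℝ => wG φ u S c (W + s • v) v)
    _ hs0.1 (fun s _ => (hasDeriv_wG φ hφ hφ' u S c W v v s).continuousAt.continuousWithinAt)
    (fun s _ => hasDeriv_wG φ hφ hφ' u S c W v v s)
  have h1 := hH (W + r • v) v
  rw [hr] at h1
  simp only [zero_smul, add_zero, sub_zero, one_smul, div_one] at hs h1
  rw [div_le_iff₀ hs0.1] at h1
  have h2 : wG φ u S c W v = -(η * ‖g‖ ^ 2) := by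
    rw [← inner_grad φ hφ, ← hg, hv, inner_neg_right, inner_smul_right, real_inner_self_eq_norm_sq]
  have h3 : W - η • g = W + v := by rw [hv, sub_eq_add_neg]
  rw [h3]
  have h4 : ρ * ‖v‖ ^ 2 * s ≤ ρ * ‖v‖ ^ 2 :=
    mul_le_of_le_one_right (by positivity) hs0.2.le
  have h5 : ρ * ‖v‖ ^ 2 ≤ η / 2 * ‖g‖ ^ 2 := by
    rw [hvn]
    have : 0 ≤ η * ‖g‖ ^ 2 := by positivity
    nlinarith
  linarith

lemma iter_bound {d m : ℕ} (L : Param d m → ℝ) (η : ℝ) (hη : 0 < η) (W0 : Param d m)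
    (hd : ∀ W, L (W - η • gradient L W) ≤ L W - η / 2 * ‖gradient L W‖ ^ 2) (t : ℕ) :
    ‖gdIter η L W0 t - W0‖ ^ 2 ≤ 2 * η * t * (L W0 - L (gdIter η L W0 t)) := by
  have key : ∀ t : ℕ, ∃ a : ℝ, 0 ≤ a ∧ ‖gdIter η L W0 t - W0‖ ≤ a ∧
      L (gdIter η L W0 t) ≤ L W0 ∧
      a ^ 2 ≤ 2 * η * t * (L W0 - L (gdIter η L W0 t)) := by
    intro t
    induction t with
    | zero => exact ⟨0, le_rfl, by simp [gdIter], by simp [gdIter], by simp⟩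
    | succ t ih =>
      obtain ⟨a, ha0, ha, hle, hq⟩ := ih
      have hs : gdIter η L W0 (t + 1)
        = gdIter η L W0 t - η • gradient L (gdIter η L W0 t) := rfl
      have h1 := hd (gdIter η L W0 t)
      rw [← hs] at h1
      set V := gdIter η L W0 t
      set V' := gdIter η L W0 (t + 1)
      set q := ‖gradient L V‖
      have hq0 : 0 ≤ q := norm_nonneg _
      refine ⟨a + η * q, by positivity, ?_, ?_, ?_⟩
      · have : V' - W0 = (V - W0) - η • gradient L V := by rw [hs]; abel
        rw [this]
        refine (norm_sub_le _ _).trans ?_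
        rw [norm_smul, Real.norm_of_nonneg hη.le]
        gcongr
      · have : 0 ≤ η / 2 * q ^ 2 := by positivity
        linarith
      · have hX : 0 ≤ L W0 - L V := by linarith
        set X := L W0 - L V
        have h2 : X + η / 2 * q ^ 2 ≤ L W0 - L V' := by simp only [X]; linarith
        push_cast
        have h3 : 2 * η * (t + 1) * (X + η / 2 * q ^ 2) ≤ 2 * η * (t + 1) * (L W0 - L V') :=
          mul_le_mul_of_nonneg_left h2 (by positivity)
        refine le_trans ?_ h3
        have ht : (0 : ℝ) ≤ t := by positivity
        -- (a + ηq)^2 ≤ (t+1)(2ηX + η²q²)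
        have h4 : (2 * a * (η * q)) ≤ 2 * η * X + t * (η * q) ^ 2 := by
          refine abs_le_of_sq_le_sq' ?_ (by positivity) |>.2
          have h5 : (2 * a * (η * q)) ^ 2 ≤ 4 * (2 * η * X) * (t * (η * q) ^ 2) := by
            have := mul_le_mul_of_nonneg_right hq (sq_nonneg (2 * (η * q)))
            nlinarith
          nlinarith [sq_nonneg (2 * η * X - t * (η * q) ^ 2)]
        nlinarith
  obtain ⟨a, ha0, ha, -, hq⟩ := key t
  exact (pow_le_pow_left₀ (norm_nonneg _) ha 2).trans hq

lemma empRisk_eq {d m n : ℕ} (φ : ℝ → ℝ) (u : Fin m → ℝ) (S : Fin n → Input d × ℝ) :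
    (empRisk φ u S : Param d m → ℝ) = wR φ u S (fun _ => 1 / (n : ℝ)) := by
  funext W
  simp only [empRisk, wR, Finset.sum_div]
  exact Finset.sum_congr rfl fun j _ => by ring

lemma looRisk_eq {d m n : ℕ} (φ : ℝ → ℝ) (u : Fin m → ℝ) (S : Fin n → Input d × ℝ) (i : Fin n) :
    (looRisk φ u S i : Param d m → ℝ) = wR φ u S (fun j => if j = i then 0 else 1 / (n : ℝ)) := by
  funext W
  rw [looRisk, empRisk_eq, wR, wR, ← Finset.add_sum_erase _ _ (Finset.mem_univ i),
    ← Finset.add_sum_erase univ (fun j => (if j = i then 0 else 1 / (n : ℝ)) * _) (Finset.mem_univ i)]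
  have : ∑ x ∈ univ.erase i, (if x = i then 0 else 1 / (n : ℝ)) * sqLoss φ u W (S x)
      = ∑ x ∈ univ.erase i, 1 / (n : ℝ) * sqLoss φ u W (S x) :=
    Finset.sum_congr rfl fun j hj => by rw [if_neg (Finset.ne_of_mem_erase hj)]
  rw [this]
  simp
  ring

/-- distance travelled by GD -/
lemma travel {d m n : ℕ} (hm : 1 ≤ m) (hn : 1 ≤ n)
    (φ : ℝ → ℝ) (B B' B'' : ℝ)
    (hφ : Differentiable ℝ φ) (hφ' : Differentiable ℝ (deriv φ))
    (hB : ∀ s : ℝ, |φ s| ≤ B) (hB' : ∀ s : ℝ, |deriv φ s| ≤ B')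
    (hB'' : ∀ s : ℝ, |deriv (deriv φ) s| ≤ B'')
    (u : Fin m → ℝ) (hu : ∀ k, u k = 1 / Real.sqrt m ∨ u k = -(1 / Real.sqrt m))
    (Cx Cy C0 : ℝ)
    (S : Fin n → Input d × ℝ)
    (hx : ∀ j, ‖(S j).1‖ ≤ Cx) (hy : ∀ j, |(S j).2| ≤ Cy)
    (W0 : Param d m) (hl0 : ∀ j, sqLoss φ u W0 (S j) ≤ C0)
    (η : ℝ) (hη0 : 0 < η)
    (ρ : ℝ) (hρ : ρ = Cx ^ 2 * (B' ^ 2 + B'' * B + B'' * Cy / Real.sqrt m)) (hρ0 : 0 ≤ ρ)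
    (hηρ : η * ρ ≤ 1 / 2) (t : ℕ) :
    ‖gdIter η (empRisk φ u S) W0 t - W0‖ ≤ Real.sqrt 2 * Real.sqrt C0 * Real.sqrt (η * t) := by
  have hn' : (0 : ℝ) < n := by exact_mod_cast hn
  have hC0 : 0 ≤ C0 := le_trans (by unfold sqLoss; positivity) (hl0 ⟨0, hn⟩)
  have hc1 : ∑ j : Fin n, (1 / (n : ℝ)) = 1 := by simp; field_simp
  rw [empRisk_eq]
  have hd := descent φ hφ hφ' u S (fun _ => 1 / (n : ℝ)) ρ η hρ0 hη0 hηρ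
    (fun W v => wH_upper φ u S _ (fun _ => by positivity) hc1.le W v _ (by positivity)
      (fun j => by
        rw [hρ]; exact Hl_upper hm φ B B' B'' hB hB' hB'' u hu (S j) Cx Cy (hx j) (hy j) W v))
  have h := iter_bound _ η hη0 W0 hd t
  have h1 : wR φ u S (fun _ => 1 / (n : ℝ)) W0 ≤ C0 := by
    calc _ ≤ ∑ j : Fin n, (1 / (n : ℝ)) * C0 :=
          Finset.sum_le_sum fun j _ => mul_le_mul_of_nonneg_left (hl0 j) (by positivity)
      _ = C0 := by rw [← Finset.sum_mul, hc1, one_mul]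
  have h2 : 0 ≤ wR φ u S (fun _ => 1 / (n : ℝ))
      (gdIter η (wR φ u S (fun _ => 1 / (n : ℝ))) W0 t) :=
    Finset.sum_nonneg fun j _ => by unfold sqLoss; positivity
  refine abs_le_of_sq_le_sq ?_ (by positivity) |> (le_abs_self _).trans
  rw [mul_pow, mul_pow, Real.sq_sqrt (by norm_num), Real.sq_sqrt hC0, Real.sq_sqrt (by positivity)]
  refine h.trans ?_
  have : 2 * η * t * (wR φ u S (fun _ => 1 / (n : ℝ)) W0 - wR φ u S (fun _ => 1 / (n : ℝ))
      (gdIter η (wR φ u S (fun _ => 1 / (n : ℝ))) W0 t)) ≤ 2 * η * t * C0 :=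
    mul_le_mul_of_nonneg_left (by linarith) (by positivity)
  linarith

/-- abstract non-expansiveness -/
lemma nonexp {d m n : ℕ} (φ : ℝ → ℝ) (hφ : Differentiable ℝ φ)
    (hφ' : Differentiable ℝ (deriv φ)) (u : Fin m → ℝ) (S : Fin n → Input d × ℝ) (c : Fin n → ℝ)
    (η e : ℝ) (he : 0 ≤ e) (V W : Param d m)
    (hlo : ∀ s ∈ Set.Ioo (0 : ℝ) 1, ∀ v, η * wH φ u S c (V + s • (W - V)) v v ≤ 1 * ‖v‖ ^ 2)
    (hup : ∀ s ∈ Set.Ioo (0 : ℝ) 1, ∀ v, -(e * ‖v‖ ^ 2) ≤ η * wH φ u S c (V + s • (W - V)) v v) :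
    ‖W - V - η • (gradient (wR φ u S c) W - gradient (wR φ u S c) V)‖ ^ 2
      ≤ (1 + e) ^ 2 * ‖W - V‖ ^ 2 := by
  set v := W - V with hv
  set w := v - η • (gradient (wR φ u S c) W - gradient (wR φ u S c) V) with hw
  obtain ⟨s, hs0, hs⟩ := exists_hasDerivAt_eq_slope (fun s : ℝ => wG φ u S c (V + s • v) w)
    _ zero_lt_one (fun s _ => (hasDeriv_wG φ hφ hφ' u S c V v w s).continuousAt.continuousWithinAt)
    (fun s _ => hasDeriv_wG φ hφ hφ' u S c V v w s)
  simp only [zero_smul, add_zero, sub_zero, one_smul, div_one] at hs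
  have hVW : V + v = W := by rw [hv]; abel
  rw [hVW] at hs
  have hww : ‖w‖ ^ 2 = inner ℝ v w - η * wH φ u S c (V + s • v) v w := by
    rw [hs, ← inner_grad φ hφ, ← inner_grad φ hφ, ← inner_sub_left, ← real_inner_smul_left,
      ← inner_sub_left, ← hw, real_inner_self_eq_norm_sq]
  have hc : 0 < 1 + e := by linarith
  set r := (1 + e)⁻¹ with hr
  have e1 := wH_comb φ u S c (V + s • v) v w r
  have e2 := wH_comb φ u S c (V + s • v) v w (-r)
  have n1 : ‖v + r • w‖ ^ 2 = ‖v‖ ^ 2 + 2 * r * inner ℝ v w + r ^ 2 * ‖w‖ ^ 2 := by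
    rw [norm_add_sq_real, real_inner_smul_right, norm_smul, mul_pow, Real.norm_eq_abs, sq_abs]
    ring
  have n2 : ‖v + (-r) • w‖ ^ 2 = ‖v‖ ^ 2 - 2 * r * inner ℝ v w + r ^ 2 * ‖w‖ ^ 2 := by
    rw [norm_add_sq_real, real_inner_smul_right, norm_smul, mul_pow, Real.norm_eq_abs, sq_abs]
    ring
  have a1 := hup s hs0 (v + r • w)
  have a2 := hlo s hs0 (v + (-r) • w)
  have p2 := sq_nonneg ‖v + (-r) • w‖
  rw [e1, n1] at a1
  rw [e2, n2] at a2
  rw [n2] at p2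
  -- 4 r ‖w‖² ≤ (1+e) * 2 (‖v‖² + r² ‖w‖²)
  have k1 : 4 * r * ‖w‖ ^ 2 ≤ (1 + e) * (2 * ‖v‖ ^ 2 + 2 * r ^ 2 * ‖w‖ ^ 2) := by
    have q2 : 0 ≤ e * (‖v‖ ^ 2 - 2 * r * inner ℝ v w + r ^ 2 * ‖w‖ ^ 2) := mul_nonneg he p2
    have q3 : 4 * r * ‖w‖ ^ 2 = 4 * r * inner ℝ v w - 4 * r * (η * wH φ u S c (V + s • v) v w) := by
      rw [hww]; ring
    nlinarith
  have k2 : (1 + e) * r = 1 := mul_inv_cancel₀ hc.ne'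
  have k3 : (1 + e) * (4 * r * ‖w‖ ^ 2)
      ≤ (1 + e) * ((1 + e) * (2 * ‖v‖ ^ 2 + 2 * r ^ 2 * ‖w‖ ^ 2)) :=
    mul_le_mul_of_nonneg_left k1 hc.le
  have k4 : (1 + e) * (4 * r * ‖w‖ ^ 2) = 4 * ‖w‖ ^ 2 := by
    linear_combination (4 * ‖w‖ ^ 2) * k2
  have k5 : (1 + e) * ((1 + e) * (2 * ‖v‖ ^ 2 + 2 * r ^ 2 * ‖w‖ ^ 2))
      = 2 * ((1 + e) ^ 2 * ‖v‖ ^ 2) + 2 * ‖w‖ ^ 2 := by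
    linear_combination (2 * ‖w‖ ^ 2) * ((1 + e) * r + 1) * k2
  linarith

end Helpers

/-- approximate non-expansiveness of the leave-one-out GD update. -/
theorem statement17 {d m n : ℕ} (hm : 1 ≤ m) (hn : 1 ≤ n)
    (φ : ℝ → ℝ) (Bφ Bφ' Bφ'' : ℝ)
    (hφ : Differentiable ℝ φ) (hφ' : Differentiable ℝ (deriv φ))
    (hBφ : ∀ s : ℝ, |φ s| ≤ Bφ) (hBφ' : ∀ s : ℝ, |deriv φ s| ≤ Bφ')
    (hBφ'' : ∀ s : ℝ, |deriv (deriv φ) s| ≤ Bφ'')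
    (u : Fin m → ℝ) (hu : ∀ k, u k = 1 / Real.sqrt m ∨ u k = -(1 / Real.sqrt m))
    (Cx Cy C0 : ℝ) (hCx : 0 < Cx) (hCy : 0 < Cy) (hC0 : 0 < C0)
    (S : Fin n → Input d × ℝ) (i : Fin n) (ztil : Input d × ℝ)
    (hx : ∀ j, ‖(S j).1‖ ≤ Cx) (hy : ∀ j, |(S j).2| ≤ Cy)
    (hxt : ‖ztil.1‖ ≤ Cx) (hyt : |ztil.2| ≤ Cy)
    (W0 : Param d m)
    (hl0 : ∀ j, sqLoss φ u W0 (S j) ≤ C0) (hl0t : sqLoss φ u W0 ztil ≤ C0)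
    (η : ℝ) (hη0 : 0 < η)
    (ρ : ℝ) (hρ : ρ = Cx ^ 2 * (Bφ' ^ 2 + Bφ'' * Bφ + Bφ'' * Cy / Real.sqrt m))
    (hη : η ≤ 1 / (2 * ρ))
    (t : ℕ) (ht : 1 ≤ t)
    (ε : ℝ) (hεdef : ε = 2 * Cx ^ 2 * Real.sqrt C0 * Bφ''
        * (4 * Bφ' * Cx * Real.sqrt (η * t) + Real.sqrt 2) / Real.sqrt m)
    (hε : 2 * η * ε < 1) :
    ‖gdIter η (empRisk φ u S) W0 t
        - gdIter η (empRisk φ u (Function.update S i ztil)) W0 t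
        - η • (gradient (looRisk φ u S i) (gdIter η (empRisk φ u S) W0 t)
            - gradient (looRisk φ u S i)
                (gdIter η (empRisk φ u (Function.update S i ztil)) W0 t))‖ ^ 2
      ≤ (1 / (1 - 2 * η * ε))
          * ‖gdIter η (empRisk φ u S) W0 t
              - gdIter η (empRisk φ u (Function.update S i ztil)) W0 t‖ ^ 2 := by
  have hm' : (0 : ℝ) < m := by exact_mod_cast hm
  have hn' : (0 : ℝ) < n := by exact_mod_cast hn
  have hsm : 0 < Real.sqrt m := Real.sqrt_pos.2 hm'
  have hB0 : 0 ≤ Bφ := (abs_nonneg _).trans (hBφ 0)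
  have hB0' : 0 ≤ Bφ' := (abs_nonneg _).trans (hBφ' 0)
  have hB0'' : 0 ≤ Bφ'' := (abs_nonneg _).trans (hBφ'' 0)
  have hρ0 : 0 ≤ ρ := by rw [hρ]; positivity
  have hηρ : η * ρ ≤ 1 / 2 := by
    rcases hρ0.eq_or_lt with h | h
    · rw [← h] at hη; norm_num at hη; linarith
    · rw [le_div_iff₀ (by positivity)] at hη; linarith
  have hε0 : 0 ≤ ε := by rw [hεdef]; positivity
  have hW := travel hm hn φ Bφ Bφ' Bφ'' hφ hφ' hBφ hBφ' hBφ'' u hu Cx Cy C0 S hx hy W0 hl0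
    η hη0 ρ hρ hρ0 hηρ t
  have hup : ∀ (P : Input d × ℝ → Prop), (∀ j, P (S j)) → P ztil →
      ∀ j, P (Function.update S i ztil j) := by
    intro P h1 h2 j
    by_cases hj : j = i
    · subst hj; simpa using h2
    · simpa [Function.update_of_ne hj] using h1 j
  have hV := travel hm hn φ Bφ Bφ' Bφ'' hφ hφ' hBφ hBφ' hBφ'' u hu Cx Cy C0
    (Function.update S i ztil) (hup (fun z => ‖z.1‖ ≤ Cx) hx hxt)
    (hup (fun z => |z.2| ≤ Cy) hy hyt) W0
    (hup (fun z => sqLoss φ u W0 z ≤ C0) hl0 hl0t) η hη0 ρ hρ hρ0 hηρ t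
  set W := gdIter η (empRisk φ u S) W0 t
  set V := gdIter η (empRisk φ u (Function.update S i ztil)) W0 t
  rw [looRisk_eq]
  set c : Fin n → ℝ := fun j => if j = i then 0 else 1 / (n : ℝ) with hcdef
  have hc : ∀ j, 0 ≤ c j := fun j => by
    simp only [hcdef]; split_ifs <;> positivity
  have hc1 : ∑ j, c j ≤ 1 := by
    calc ∑ j, c j ≤ ∑ j : Fin n, 1 / (n : ℝ) := Finset.sum_le_sum fun j _ => by
          simp only [hcdef]; split_ifs
          · positivity
          · exact le_rfl
      _ = 1 := by simp; field_simp
  have hmain := nonexp φ hφ hφ' u S c η (η * ε) (by positivity) V W ?_ ?_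
  · refine hmain.trans ?_
    refine mul_le_mul_of_nonneg_right ?_ (sq_nonneg _)
    rw [le_div_iff₀ (by linarith)]
    have ha : 0 ≤ η * ε := by positivity
    have : 0 ≤ (η * ε) ^ 3 := by positivity
    nlinarith [sq_nonneg (η * ε)]
  · intro s _ v
    have h := wH_upper φ u S c hc hc1 (V + s • (W - V)) v (ρ * ‖v‖ ^ 2) (by positivity)
      (fun j => by
        rw [hρ]
        exact Hl_upper hm φ Bφ Bφ' Bφ'' hBφ hBφ' hBφ'' u hu (S j) Cx Cy (hx j) (hy j) _ v)
    have h2 := mul_le_mul_of_nonneg_left h hη0.le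
    have h3 := mul_le_mul_of_nonneg_right hηρ (sq_nonneg ‖v‖)
    nlinarith [sq_nonneg ‖v‖]
  · intro s hs v
    set U := V + s • (W - V) with hU
    set R := Real.sqrt 2 * Real.sqrt C0 * Real.sqrt (η * t) with hR
    have hR0 : 0 ≤ R := by positivity
    have hUR : ‖U - W0‖ ≤ R := by
      have h1 : U - W0 = (1 - s) • (V - W0) + s • (W - W0) := by rw [hU]; module
      rw [h1]
      refine (norm_add_le _ _).trans ?_
      rw [norm_smul, norm_smul, Real.norm_of_nonneg (by linarith [hs.2]),
        Real.norm_of_nonneg hs.1.le]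
      nlinarith [mul_le_mul_of_nonneg_left hV (sub_nonneg.2 hs.2.le),
        mul_le_mul_of_nonneg_left hW hs.1.le]
    have hb : ∀ j, |nnet φ u U (S j).1 - (S j).2|
        ≤ 2 * Real.sqrt C0 * (4 * Bφ' * Cx * Real.sqrt (η * t) + Real.sqrt 2) := by
      intro j
      have h1 := nnet_lip hm φ hφ Bφ' hBφ' u hu (S j).1 Cx hCx (hx j) U W0
      have h2 : |nnet φ u W0 (S j).1 - (S j).2| ≤ Real.sqrt 2 * Real.sqrt C0 := by
        refine abs_le_of_sq_le_sq ?_ (by positivity)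
        rw [mul_pow, Real.sq_sqrt (by norm_num), Real.sq_sqrt hC0.le]
        have := hl0 j
        unfold sqLoss at this
        linarith
      have h3 := abs_sub_le (nnet φ u U (S j).1) (nnet φ u W0 (S j).1) (S j).2
      have h4 : Bφ' * Cx * ‖U - W0‖ ≤ Bφ' * Cx * R :=
        mul_le_mul_of_nonneg_left hUR (by positivity)
      have h5 : Real.sqrt 2 ≤ 2 := by
        rw [Real.sqrt_le_left (by norm_num)]; norm_num
      have h6 : Bφ' * Cx * R ≤ 8 * (Bφ' * Cx * (Real.sqrt C0 * Real.sqrt (η * t))) := by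
        have : 0 ≤ Bφ' * Cx * (Real.sqrt C0 * Real.sqrt (η * t)) := by positivity
        rw [hR]
        nlinarith
      have h7 : 0 ≤ Real.sqrt 2 * Real.sqrt C0 := by positivity
      linarith
    have h := wH_lower φ u S c hc hc1 U v (ε * ‖v‖ ^ 2) (by positivity) (fun j => by
      have := Hl_lower hm φ Bφ'' hBφ'' u hu (S j) Cx (hx j) U v _ (hb j)
      refine le_trans (le_of_eq ?_) this
      rw [hεdef]
      ring)
    have h2 := mul_le_mul_of_nonneg_left h hη0.le
    linarith
end
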